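/- The even-sieved part of McIntosh's mock theta function B(q) is an eta quotient: [B(q) | S_{2,0}]_{q↦q^{1/2}} = (q²;q²)_∞⁵ / (q;q)_∞⁴, i.e., Σ_{n≥0} b(2n) q^n = (q²;q²)_∞⁵ / (q;q)_∞⁴, where B(q) = Σ_{n≥0} b(n) q^n. -/

import Mathlib

open scoped BigOperators

/-- Infinite q-Pochhammer symbol `(a; q)_∞`. -/
noncomputable def pochInf (a q : ℂ) : ℂ := ∏' j : ℕ, (1 - a * q ^ j)

/-- Finite q-Pochhammer symbol `(a; q)_n`. -/
noncomputable def pochN (a q : ℂ) (n : ℕ) : ℂ := ∏ j ∈ Finset.range n, (1 - a * q ^ j)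

/-- McIntosh's second order mock theta function
`B(q) = Σ_{n ≥ 0} (−q²; q²)_n q^{n(n+1)} / (q; q²)_{n+1}²`. -/
noncomputable def Bmock (q : ℂ) : ℂ :=
  ∑' n : ℕ, pochN (-q ^ 2) (q ^ 2) n * q ^ (n * (n + 1)) / pochN q (q ^ 2) (n + 1) ^ 2

open Finset Filter Topology

lemma pochN_zero (a q : ℂ) : pochN a q 0 = 1 := by simp [pochN]

lemma pochN_succ (a q : ℂ) (n : ℕ) : pochN a q (n + 1) = pochN a q n * (1 - a * q ^ n) := by
  simp [pochN, prod_range_succ]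

lemma pochN_self_succ (q : ℂ) (n : ℕ) : pochN q q (n + 1) = pochN q q n * (1 - q ^ (n + 1)) := by
  rw [pochN_succ, pow_succ']

lemma one_sub_ne_zero {w : ℂ} (hw : ‖w‖ < 1) : 1 - w ≠ 0 := by
  intro h
  rw [← sub_eq_zero.mp h] at hw
  simp at hw

lemma norm_pow_succ_lt_one {q : ℂ} (hq : ‖q‖ < 1) (n : ℕ) : ‖q ^ (n + 1)‖ < 1 := by
  rw [norm_pow]
  exact pow_lt_one₀ (norm_nonneg _) hq n.succ_ne_zero

lemma one_sub_pow_succ_ne_zero {q : ℂ} (hq : ‖q‖ < 1) (n : ℕ) : 1 - q ^ (n + 1) ≠ 0 :=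
  one_sub_ne_zero (norm_pow_succ_lt_one hq n)

lemma norm_mul_pow_lt_one {a q : ℂ} (ha : ‖a‖ < 1) (hq : ‖q‖ < 1) (n : ℕ) : ‖a * q ^ n‖ < 1 := by
  rw [norm_mul, norm_pow]
  exact mul_lt_one_of_nonneg_of_lt_one_left (norm_nonneg _) ha (pow_le_one₀ (norm_nonneg _) hq.le)

lemma pochN_ne_zero {a q : ℂ} (ha : ‖a‖ < 1) (hq : ‖q‖ < 1) (n : ℕ) : pochN a q n ≠ 0 :=
  prod_ne_zero_iff.mpr fun j _ => one_sub_ne_zero (norm_mul_pow_lt_one ha hq j)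

/-- The finite q-binomial convolution `(x; q)_N`, homogenized in `x` and `y`, vanishes at
`y = x q ^ n` for `n < N`. -/
lemma qBinomial_antidiagonal_eq_zero {q : ℂ} (hq : ‖q‖ < 1) (n N : ℕ) (hn : n < N) (x : ℂ) :
    ∑ p ∈ antidiagonal N, (-x) ^ p.1 * q ^ (p.1.choose 2) / pochN q q p.1 *
      ((x * q ^ n) ^ p.2 / pochN q q p.2) = 0 := by
  have key : ∀ (N : ℕ) (x y : ℂ), (1 - q ^ (N + 1)) *
      ∑ p ∈ antidiagonal (N + 1), (-x) ^ p.1 * q ^ (p.1.choose 2) / pochN q q p.1 *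
        (y ^ p.2 / pochN q q p.2) = (y - x) *
      ∑ p ∈ antidiagonal N, (-(x * q)) ^ p.1 * q ^ (p.1.choose 2) / pochN q q p.1 *
        (y ^ p.2 / pochN q q p.2) := by
    intro N x y
    have hsplit : (1 - q ^ (N + 1)) *
        ∑ p ∈ antidiagonal (N + 1), (-x) ^ p.1 * q ^ (p.1.choose 2) / pochN q q p.1 *
          (y ^ p.2 / pochN q q p.2) =
        ∑ p ∈ antidiagonal (N + 1), (1 - q ^ p.1) *
          ((-x) ^ p.1 * q ^ (p.1.choose 2) / pochN q q p.1 * (y ^ p.2 / pochN q q p.2)) +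
        ∑ p ∈ antidiagonal (N + 1), q ^ p.1 * (1 - q ^ p.2) *
          ((-x) ^ p.1 * q ^ (p.1.choose 2) / pochN q q p.1 * (y ^ p.2 / pochN q q p.2)) := by
      rw [mul_sum, ← sum_add_distrib]
      refine sum_congr rfl fun p hp => ?_
      rw [← mem_antidiagonal.mp hp, pow_add]
      ring
    rw [hsplit, Nat.sum_antidiagonal_succ, Nat.sum_antidiagonal_succ', mul_sum]
    simp only [pow_zero, sub_self, zero_mul, mul_zero, zero_add]
    rw [← sum_add_distrib]
    refine sum_congr rfl fun p _ => ?_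
    have h1 := one_sub_pow_succ_ne_zero hq p.1
    have h2 := one_sub_pow_succ_ne_zero hq p.2
    have h3 := pochN_ne_zero hq hq p.1
    have h4 := pochN_ne_zero hq hq p.2
    have h5 : (p.1 + 1).choose 2 = p.1 + p.1.choose 2 := by
      rw [Nat.choose_succ_succ' p.1 1, Nat.choose_one_right]
    rw [pochN_self_succ, pochN_self_succ, h5, pow_add q p.1 (p.1.choose 2)]
    have h6 : (-(x * q)) ^ p.1 = (-x) ^ p.1 * q ^ p.1 := by rw [← mul_pow]; ring
    rw [h6]
    field_simp
    ring
  induction n generalizing N x with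
  | zero =>
    obtain ⟨N, rfl⟩ := Nat.exists_eq_add_of_lt hn
    have := key (0 + N) x (x * q ^ 0)
    simp only [pow_zero, mul_one, sub_self, zero_mul] at this ⊢
    exact (mul_eq_zero.mp this).resolve_left (one_sub_pow_succ_ne_zero hq _)
  | succ n ih =>
    obtain ⟨N, rfl⟩ : ∃ M, N = M + 1 := ⟨N - 1, by omega⟩
    have h := key N x (x * q ^ (n + 1))
    have h' := ih N (by omega) (x * q)
    rw [show x * q * q ^ n = x * q ^ (n + 1) by ring] at h'
    rw [h', mul_zero] at h
    exact (mul_eq_zero.mp h).resolve_left (one_sub_pow_succ_ne_zero hq _)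

lemma choose_two_add (a b : ℕ) : (a + b).choose 2 = a.choose 2 + b.choose 2 + a * b := by
  induction b with
  | zero => simp
  | succ b ih =>
    rw [← add_assoc, Nat.choose_succ_succ' (a + b) 1, Nat.choose_succ_succ' b 1, ih]
    simp only [Nat.choose_one_right]
    ring

/-- The weight `1 / ((q; q)_{n-k} (q; q)_{n+k+1})`, zero for `k > n`. -/
noncomputable def baileyWeight (q : ℂ) (n k : ℕ) : ℂ :=
  if k ≤ n then 1 / (pochN q q (n - k) * pochN q q (n + k + 1)) else 0

lemma baileyWeight_add (q : ℂ) (k l : ℕ) :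
    baileyWeight q (k + l) k = 1 / (pochN q q l * pochN q q (2 * k + l + 1)) := by
  simp only [baileyWeight, Nat.le_add_right, if_true, Nat.add_sub_cancel_left]
  congr 3
  ring

/-- Orthogonality relation of the Bailey transform. -/
lemma sum_baileyWeight_eq_zero {q : ℂ} (hq : ‖q‖ < 1) (n : ℕ) :
    ∑ k ∈ range (n + 2), (-1) ^ k * q ^ ((k + 1).choose 2) *
      (q ^ (n + 1 - k) - q ^ (n + 1 + k + 1)) * baileyWeight q (n + 1) k = 0 := by
  rcases eq_or_ne q 0 with rfl | hq0
  · refine sum_eq_zero fun k hk => ?_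
    rcases k with _ | k
    · simp
    · have : (k + 1 + 1).choose 2 ≠ 0 := (Nat.choose_pos (by omega)).ne'
      simp [this]
  set m := n + 1
  have h := qBinomial_antidiagonal_eq_zero hq m (2 * m) (by omega) 1
  rw [Nat.sum_antidiagonal_eq_sum_range_succ_mk, show (2 * m).succ = (m + 1) + m by omega,
    sum_range_add, ← sum_range_reflect] at h
  set e := m.choose 2 + m * m with he
  have hA : ∀ k ∈ range (m + 1), (-1 : ℂ) ^ (m + 1 - 1 - k) *
        q ^ ((m + 1 - 1 - k).choose 2) / pochN q q (m + 1 - 1 - k) *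
        ((1 * q ^ m) ^ (2 * m - (m + 1 - 1 - k)) / pochN q q (2 * m - (m + 1 - 1 - k))) =
      (-1) ^ m * q ^ e * ((-1) ^ k * q ^ ((k + 1).choose 2) *
        (1 / (pochN q q (m - k) * pochN q q (m + k)))) := by
    intro k hk
    obtain ⟨l, hl⟩ : ∃ l, m = k + l := ⟨m - k, by have := mem_range.mp hk; omega⟩
    rw [show m + 1 - 1 - k = l by omega, show 2 * m - l = m + k by omega,
      show m - k = l by omega, one_mul, ← pow_mul]
    have h1 : q ^ e * q ^ ((k + 1).choose 2) = q ^ (l.choose 2) * q ^ (m * (m + k)) := by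
      rw [← pow_add, ← pow_add, he, hl, choose_two_add, choose_two_add k 1]
      congr 1
      have h2 : k * k = 2 * k.choose 2 + k := by
        clear * -
        induction k with
        | zero => rfl
        | succ k ih => rw [choose_two_add]; simp; linarith
      simp
      linarith
    have h2 : (-1 : ℂ) ^ m * (-1) ^ k = (-1) ^ l := by
      rw [hl, ← pow_add, show k + l + k = l + 2 * k by ring, pow_add, pow_mul]; simp
    rw [← h2]
    linear_combination (-(-1) ^ m * (-1) ^ k / (pochN q q l * pochN q q (m + k))) * h1
  have hB : ∀ k ∈ range m, (-1 : ℂ) ^ (m + 1 + k) *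
        q ^ ((m + 1 + k).choose 2) / pochN q q (m + 1 + k) *
        ((1 * q ^ m) ^ (2 * m - (m + 1 + k)) / pochN q q (2 * m - (m + 1 + k))) =
      - ((-1) ^ m * q ^ e * ((-1) ^ k * q ^ ((k + 1).choose 2) *
        ((1 - q ^ (m - k)) / (pochN q q (m - k) * pochN q q (m + k + 1))))) := by
    intro k hk
    obtain ⟨l, hl⟩ : ∃ l, m = k + l + 1 := ⟨m - k - 1, by have := mem_range.mp hk; omega⟩
    rw [show 2 * m - (m + 1 + k) = l by omega, show m - k = l + 1 by omega, one_mul, ← pow_mul,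
      pochN_self_succ, show m + k + 1 = m + 1 + k by ring, pow_add (-1 : ℂ) (m + 1) k,
      pow_succ (-1 : ℂ) m]
    have h1 : q ^ e * q ^ ((k + 1).choose 2) = q ^ ((m + 1 + k).choose 2) * q ^ (m * l) := by
      rw [← pow_add, ← pow_add, he, add_assoc m, add_comm 1 k, choose_two_add m (k + 1)]
      congr 1
      rw [hl]
      ring
    have h2 := one_sub_pow_succ_ne_zero hq l
    have h3 := pochN_ne_zero hq hq l
    have h4 := pochN_ne_zero hq hq (m + 1 + k)
    field_simp
    linear_combination h1
  rw [sum_congr rfl hA, sum_congr rfl hB] at h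
  have hB' : ∑ k ∈ range m, -((-1) ^ m * q ^ e * ((-1) ^ k * q ^ ((k + 1).choose 2) *
        ((1 - q ^ (m - k)) / (pochN q q (m - k) * pochN q q (m + k + 1))))) =
      ∑ k ∈ range (m + 1), -((-1) ^ m * q ^ e * ((-1) ^ k * q ^ ((k + 1).choose 2) *
        ((1 - q ^ (m - k)) / (pochN q q (m - k) * pochN q q (m + k + 1))))) := by
    rw [sum_range_succ _ m]; simp
  rw [hB', ← sum_add_distrib] at h
  have hc : (-1 : ℂ) ^ m * q ^ e ≠ 0 := by simp [hq0]
  refine (mul_eq_zero.mp ?_).resolve_left hc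
  rw [← h, mul_sum]
  refine sum_congr rfl fun k hk => ?_
  have hk' : k ≤ m := by have := mem_range.mp hk; omega
  have h2 := one_sub_pow_succ_ne_zero hq (m + k)
  have h3 := pochN_ne_zero hq hq (m - k)
  have h4 := pochN_ne_zero hq hq (m + k)
  rw [baileyWeight, if_pos hk', pochN_self_succ]
  field_simp
  ring

lemma baileyWeight_succ {q : ℂ} (hq : ‖q‖ < 1) {n k : ℕ} (hk : k ≤ n + 1) :
    baileyWeight q n k =
      baileyWeight q (n + 1) k * ((1 - q ^ (n + 1 - k)) * (1 - q ^ (n + 1 + k + 1))) := by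
  rcases hk.eq_or_lt with rfl | hk
  · simp [baileyWeight]
  · have hk : k ≤ n := by omega
    obtain ⟨l, rfl⟩ := Nat.exists_eq_add_of_le hk
    have h := baileyWeight_add q k (l + 1)
    rw [← add_assoc] at h
    rw [h, baileyWeight_add, show k + l + 1 - k = l + 1 by omega,
      show k + l + 1 + k + 1 = 2 * k + l + 1 + 1 by ring, pochN_self_succ q l,
      show 2 * k + (l + 1) + 1 = 2 * k + l + 1 + 1 by ring, pochN_self_succ q (2 * k + l + 1)]
    have h1 := one_sub_pow_succ_ne_zero hq l
    have h2 := one_sub_pow_succ_ne_zero hq (2 * k + l + 1)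
    have h3 := pochN_ne_zero hq hq l
    have h4 := pochN_ne_zero hq hq (2 * k + l + 1)
    field_simp

/-- Partial fraction expansion of `1 / (z; z²)_{n+1}²`. -/
lemma sum_baileyWeight_eq_inv_sq {z : ℂ} (hz : ‖z‖ < 1) (n : ℕ) :
    ∑ k ∈ range (n + 1), (-1) ^ k * (z ^ 2) ^ ((k + 1).choose 2) *
      ((1 + z ^ (2 * k + 1)) / (1 - z ^ (2 * k + 1))) * baileyWeight (z ^ 2) n k =
      1 / pochN z (z ^ 2) (n + 1) ^ 2 := by
  have hq : ‖z ^ 2‖ < 1 := norm_pow_succ_lt_one hz 1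
  induction n with
  | zero =>
    have h1 := one_sub_pow_succ_ne_zero hz 0
    have h2 := one_sub_pow_succ_ne_zero hz 1
    simp [baileyWeight, pochN] at *
    field_simp
    ring
  | succ n ih =>
    have hs := one_sub_pow_succ_ne_zero hz (2 * n + 2)
    have hP := pochN_ne_zero hz hq (n + 1)
    have h1 : ∑ k ∈ range (n + 2), (-1) ^ k * (z ^ 2) ^ ((k + 1).choose 2) *
        ((1 + z ^ (2 * k + 1)) / (1 - z ^ (2 * k + 1))) * baileyWeight (z ^ 2) n k =
        1 / pochN z (z ^ 2) (n + 1) ^ 2 := by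
      rw [sum_range_succ, ih]
      simp [baileyWeight]
    have h0 := sum_baileyWeight_eq_zero hq n
    rw [pochN_succ, show z * (z ^ 2) ^ (n + 1) = z ^ (2 * n + 2 + 1) by ring, mul_pow]
    have h2 : (1 - z ^ (2 * n + 2 + 1)) ^ 2 *
        ∑ k ∈ range (n + 2), (-1) ^ k * (z ^ 2) ^ ((k + 1).choose 2) *
          ((1 + z ^ (2 * k + 1)) / (1 - z ^ (2 * k + 1))) * baileyWeight (z ^ 2) (n + 1) k =
        1 / pochN z (z ^ 2) (n + 1) ^ 2 := by
      rw [← h1, ← sub_eq_zero, mul_sum, ← sum_sub_distrib, ← h0]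
      refine sum_congr rfl fun k hk => ?_
      have hk' : k ≤ n + 1 := by have := mem_range.mp hk; omega
      rw [baileyWeight_succ hq hk']
      obtain ⟨l, hl⟩ := Nat.exists_eq_add_of_le hk'
      have h3 := one_sub_pow_succ_ne_zero hz (2 * k)
      rw [show n + 1 - k = l by omega, show n + 1 + k + 1 = 2 * k + l + 1 by omega,
        show 2 * n + 2 + 1 = 2 * k + 2 * l + 1 by omega]
      field_simp
      ring
    rw [eq_div_iff (mul_ne_zero (pow_ne_zero 2 hP) (pow_ne_zero 2 hs))]
    rw [eq_div_iff (pow_ne_zero 2 hP)] at h2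
    linear_combination h2

lemma summable_norm_mul_pow (a : ℂ) {q : ℂ} (hq : ‖q‖ < 1) :
    Summable fun j : ℕ => ‖-(a * q ^ j)‖ := by
  simpa using (summable_geometric_of_lt_one (norm_nonneg _) hq).mul_left ‖a‖

lemma multipliable_pochInf (a : ℂ) {q : ℂ} (hq : ‖q‖ < 1) :
    Multipliable fun j : ℕ => 1 - a * q ^ j := by
  simpa only [sub_eq_add_neg] using multipliable_one_add_of_summable (summable_norm_mul_pow a hq)

lemma tendsto_pochN (a : ℂ) {q : ℂ} (hq : ‖q‖ < 1) :
    Tendsto (pochN a q) atTop (𝓝 (pochInf a q)) :=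
  (multipliable_pochInf a hq).tendsto_prod_tprod_nat

lemma pochInf_ne_zero {a q : ℂ} (ha : ‖a‖ < 1) (hq : ‖q‖ < 1) : pochInf a q ≠ 0 := by
  have := tprod_one_add_ne_zero_of_summable (f := fun j : ℕ => -(a * q ^ j))
    (fun j => by simpa only [← sub_eq_add_neg] using one_sub_ne_zero (norm_mul_pow_lt_one ha hq j))
    (summable_norm_mul_pow a hq)
  simpa only [pochInf, sub_eq_add_neg] using this

lemma exists_norm_le_of_tendsto {u : ℕ → ℂ} {x : ℂ} (hu : Tendsto u atTop (𝓝 x)) :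
    ∃ M : ℝ, 0 ≤ M ∧ ∀ n, ‖u n‖ ≤ M := by
  obtain ⟨M, hM⟩ := isBounded_iff_forall_norm_le.mp (Metric.isBounded_range_of_tendsto u hu)
  exact ⟨M, (norm_nonneg _).trans (hM _ ⟨0, rfl⟩), fun n => hM _ ⟨n, rfl⟩⟩

lemma exists_norm_baileyWeight_le {q : ℂ} (hq : ‖q‖ < 1) :
    ∃ M : ℝ, 0 ≤ M ∧ ∀ n k, ‖baileyWeight q n k‖ ≤ M := by
  obtain ⟨M, hM0, hM⟩ := exists_norm_le_of_tendsto ((tendsto_pochN q hq).inv₀ (pochInf_ne_zero hq hq))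
  refine ⟨M * M, mul_nonneg hM0 hM0, fun n k => ?_⟩
  rw [baileyWeight]
  split_ifs
  · rw [one_div, mul_inv, norm_mul]
    exact mul_le_mul (hM _) (hM _) (norm_nonneg _) hM0
  · simpa using mul_nonneg hM0 hM0

lemma le_choose_two_succ (n : ℕ) : n ≤ (n + 1).choose 2 := by
  rw [choose_two_add]
  simp

lemma norm_pow_choose_le {q : ℂ} (hq : ‖q‖ < 1) (n : ℕ) : ‖q ^ ((n + 1).choose 2)‖ ≤ ‖q‖ ^ n := by
  rw [norm_pow]
  exact pow_le_pow_of_le_one (norm_nonneg _) hq.le (le_choose_two_succ n)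

/-- The summand of the limiting q-Gauss sum. -/
noncomputable def gaussTerm (q : ℂ) (n k : ℕ) : ℂ :=
  pochN (-q) q n * q ^ ((n + 1).choose 2) * baileyWeight q n k

lemma exists_norm_gaussTerm_le {q : ℂ} (hq : ‖q‖ < 1) :
    ∃ M : ℝ, 0 ≤ M ∧ ∀ n k, ‖gaussTerm q n k‖ ≤ M * ‖q‖ ^ n := by
  obtain ⟨M, hM0, hM⟩ := exists_norm_le_of_tendsto (tendsto_pochN (-q) hq)
  obtain ⟨L, hL0, hL⟩ := exists_norm_baileyWeight_le hq
  refine ⟨M * L, mul_nonneg hM0 hL0, fun n k => ?_⟩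
  rw [gaussTerm, norm_mul, norm_mul]
  calc _ ≤ M * ‖q‖ ^ n * L := by
        gcongr
        exacts [hM n, norm_pow_choose_le hq n, hL n k]
    _ = _ := by ring

lemma summable_gaussTerm {q : ℂ} (hq : ‖q‖ < 1) (k : ℕ) : Summable fun n => gaussTerm q n k := by
  obtain ⟨M, -, hM⟩ := exists_norm_gaussTerm_le hq
  exact ((summable_geometric_of_lt_one (norm_nonneg _) hq).mul_left M).of_norm_bounded
    fun n => hM n k

lemma gaussTerm_telescope {q : ℂ} (hq : ‖q‖ < 1) (n k : ℕ) :
    gaussTerm q n (k + 1) - q ^ (k + 1) * gaussTerm q n k =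
      -((1 - q ^ (k + 1)) * (1 - q ^ (n + 1 + k + 2)) * gaussTerm q (n + 1) (k + 1)) -
      -((1 - q ^ (k + 1)) * (1 - q ^ (n + k + 2)) * gaussTerm q n (k + 1)) := by
  rcases lt_or_ge n k with h | h
  · simp [gaussTerm, baileyWeight, show ¬ k ≤ n by omega, show ¬ k + 1 ≤ n by omega]
  obtain ⟨l, rfl⟩ := Nat.exists_eq_add_of_le h
  have h0 : baileyWeight q (k + l + 1) (k + 1) =
      1 / (pochN q q l * pochN q q (2 * k + l + 3)) := by
    rw [show k + l + 1 = (k + 1) + l by ring, baileyWeight_add]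
    congr 3
    ring
  have h1 : baileyWeight q (k + l) (k + 1) =
      (1 - q ^ l) / (pochN q q l * pochN q q (2 * k + l + 2)) := by
    rcases l with _ | l
    · simp [baileyWeight]
    · rw [show k + (l + 1) = (k + 1) + l by ring, baileyWeight_add, pochN_self_succ q l,
        show 2 * (k + 1) + l + 1 = 2 * k + (l + 1) + 2 by ring]
      have h2 := one_sub_pow_succ_ne_zero hq l
      have h3 := pochN_ne_zero hq hq l
      have h4 := pochN_ne_zero hq hq (2 * k + (l + 1) + 2)
      field_simp
  have h5 : (k + l + 1 + 1).choose 2 = (k + l + 1).choose 2 + (k + l + 1) := by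
    rw [choose_two_add (k + l + 1) 1]
    simp
  have h2 := one_sub_pow_succ_ne_zero hq (2 * k + l + 1)
  have h2' := one_sub_pow_succ_ne_zero hq (2 * k + l + 2)
  have h3 := pochN_ne_zero hq hq l
  have h4 := pochN_ne_zero hq hq (2 * k + l + 1)
  simp only [gaussTerm]
  rw [h0, h1, baileyWeight_add, pochN_succ (-q), h5, pochN_self_succ q (2 * k + l + 2),
    pochN_self_succ q (2 * k + l + 1), show k + l + 1 + k + 2 = 2 * k + l + 2 + 1 by ring,
    show k + l + k + 2 = 2 * k + l + 1 + 1 by ring]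
  field_simp
  ring

lemma tsum_gaussTerm_succ {q : ℂ} (hq : ‖q‖ < 1) (k : ℕ) :
    ∑' n, gaussTerm q n (k + 1) = q ^ (k + 1) * ∑' n, gaussTerm q n k := by
  have hs := summable_gaussTerm hq (k + 1)
  have hs' := (summable_gaussTerm hq k).mul_left (q ^ (k + 1))
  rw [← tsum_mul_left, ← sub_eq_zero, ← hs.tsum_sub hs']
  have h1 := (hs.sub hs').hasSum.tendsto_sum_nat
  simp_rw [gaussTerm_telescope hq _ k] at h1
  simp_rw [sum_range_sub (fun n => -((1 - q ^ (k + 1)) * (1 - q ^ (n + k + 2)) *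
    gaussTerm q n (k + 1)))] at h1
  simp_rw [gaussTerm_telescope hq _ k]
  refine tendsto_nhds_unique h1 ?_
  have h2 : Tendsto (fun n : ℕ => q ^ (n + k + 2)) atTop (𝓝 0) :=
    (tendsto_add_atTop_iff_nat (k + 2)).mpr (tendsto_pow_atTop_nhds_zero_of_norm_lt_one hq)
  have h3 := hs.tendsto_atTop_zero
  have h4 := (((tendsto_const_nhds (x := 1 - q ^ (k + 1))).mul
    ((tendsto_const_nhds (x := (1 : ℂ))).sub h2)).mul h3).neg
  simpa [gaussTerm, baileyWeight] using h4

lemma tsum_gaussTerm_eq_zero_term {q : ℂ} (hq : ‖q‖ < 1) (k : ℕ) :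
    ∑' n, gaussTerm q n k = q ^ ((k + 1).choose 2) * ∑' n, gaussTerm q n 0 := by
  induction k with
  | zero => simp
  | succ k ih =>
    rw [tsum_gaussTerm_succ hq, ih, choose_two_add (k + 1) 1, ← mul_assoc, ← pow_add]
    simp [add_comm]

/-- A limiting case of the q-Gauss sum. -/
lemma tsum_gaussTerm {q : ℂ} (hq : ‖q‖ < 1) (hq0 : q ≠ 0) (k : ℕ) :
    ∑' n, gaussTerm q n k = q ^ ((k + 1).choose 2) * (pochInf (-q) q / pochInf q q) := by
  rw [tsum_gaussTerm_eq_zero_term hq]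
  congr 1
  set g : ℕ → ℕ → ℂ := fun k m => pochN (-q) q (k + m) * q ^ (m.choose 2 + (k + 1) * m) *
    (1 / (pochN q q m * pochN q q (2 * k + m + 1))) with hg
  have hshift : ∀ k, ∑' m, g k m = ∑' n, gaussTerm q n 0 := by
    intro k
    have h := (summable_gaussTerm hq k).sum_add_tsum_nat_add k
    rw [sum_eq_zero (fun n hn => by
      simp [gaussTerm, baileyWeight, show ¬ k ≤ n by have := mem_range.mp hn; omega]), zero_add,
      tsum_gaussTerm_eq_zero_term hq] at h
    refine mul_left_cancel₀ (pow_ne_zero ((k + 1).choose 2) hq0) ?_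
    rw [← h, ← tsum_mul_left]
    refine tsum_congr fun m => ?_
    rw [add_comm m k, gaussTerm, baileyWeight_add, add_right_comm k m 1, choose_two_add (k + 1) m,
      hg, add_assoc, pow_add q ((k + 1).choose 2)]
    ring
  obtain ⟨M, hM0, hM⟩ := exists_norm_le_of_tendsto (tendsto_pochN (-q) hq)
  obtain ⟨L, -, hL⟩ := exists_norm_baileyWeight_le hq
  have hg' : ∀ k m, g k m = pochN (-q) q (k + m) * q ^ (m.choose 2 + (k + 1) * m) *
      baileyWeight q (k + m) k := fun k m => by rw [baileyWeight_add]
  have hlim : Tendsto (fun k => ∑' m, g k m) atTop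
      (𝓝 (∑' m, if m = 0 then pochInf (-q) q / pochInf q q else 0)) := by
    refine tendsto_tsum_of_dominated_convergence (bound := fun m => M * L * ‖q‖ ^ m)
      ((summable_geometric_of_lt_one (norm_nonneg _) hq).mul_left _) (fun m => ?_)
      (Eventually.of_forall fun k m => ?_)
    · rcases m with _ | m
      · have h1 := (tendsto_pochN q hq).comp
          (tendsto_atTop_mono (fun k : ℕ => show k ≤ 2 * k + 1 by omega) tendsto_id)
        have h2 := (tendsto_pochN (-q) hq).div h1 (pochInf_ne_zero hq hq)
        refine h2.congr fun k => ?_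
        simp [hg, pochN_zero, div_eq_mul_inv]
      · simp only [Nat.succ_ne_zero, if_false]
        refine squeeze_zero_norm (a := fun k => M * L * ‖q‖ ^ k) (fun k => ?_) ?_
        · rw [hg', norm_mul, norm_mul, norm_pow]
          calc _ ≤ M * ‖q‖ ^ k * L := by
                gcongr ?_ * ?_ * ?_
                exacts [hM _, pow_le_pow_of_le_one (norm_nonneg _) hq.le (by nlinarith), hL _ _]
            _ = _ := by ring
        · simpa using (tendsto_pow_atTop_nhds_zero_of_lt_one (norm_nonneg _) hq).const_mul (M * L)
    · rw [hg', norm_mul, norm_mul, norm_pow]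
      calc _ ≤ M * ‖q‖ ^ m * L := by
            gcongr ?_ * ?_ * ?_
            exacts [hM _, pow_le_pow_of_le_one (norm_nonneg _) hq.le (by nlinarith), hL _ _]
        _ = _ := by ring
  simp_rw [hshift] at hlim
  rw [tsum_ite_eq] at hlim
  exact tendsto_nhds_unique tendsto_const_nhds hlim

/-- The summand of the bilateral Appell–Lerch series, folded onto `ℕ`. -/
noncomputable def lerchCoeff (z : ℂ) (k : ℕ) : ℂ :=
  (-1) ^ k * (z ^ 2) ^ ((k + 1).choose 2) * ((1 + z ^ (2 * k + 1)) / (1 - z ^ (2 * k + 1)))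

lemma norm_lerchCoeff_le {z : ℂ} (hz : ‖z‖ < 1) (k : ℕ) :
    ‖lerchCoeff z k‖ ≤ 2 / (1 - ‖z‖) * ‖z ^ 2‖ ^ k := by
  have hq : ‖z ^ 2‖ < 1 := norm_pow_succ_lt_one hz 1
  have h1 : ‖z ^ (2 * k + 1)‖ ≤ ‖z‖ := by
    rw [norm_pow]
    exact pow_le_of_le_one (norm_nonneg _) hz.le (by omega)
  have h2 : ‖1 + z ^ (2 * k + 1)‖ ≤ 2 := by
    refine (norm_add_le _ _).trans ?_
    rw [norm_one]
    linarith
  have h3 : 1 - ‖z‖ ≤ ‖1 - z ^ (2 * k + 1)‖ := by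
    have := norm_sub_norm_le 1 (z ^ (2 * k + 1))
    rw [norm_one] at this
    linarith
  have h4 : 0 < 1 - ‖z‖ := by linarith
  rw [lerchCoeff, norm_mul, norm_mul, norm_div, norm_pow, norm_neg, norm_one, one_pow, one_mul,
    mul_comm]
  gcongr
  exact norm_pow_choose_le hq k

lemma tsum_lerchCoeff_mul_baileyWeight {z : ℂ} (hz : ‖z‖ < 1) (n : ℕ) :
    ∑' k, lerchCoeff z k * baileyWeight (z ^ 2) n k = 1 / pochN z (z ^ 2) (n + 1) ^ 2 := by
  rw [← sum_baileyWeight_eq_inv_sq hz, tsum_eq_sum (s := range (n + 1))]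
  · rfl
  · intro k hk
    simp [baileyWeight, show ¬ k ≤ n by simpa [Nat.lt_succ_iff] using hk]

/-- Partial fraction expansion of the reciprocal theta function `1 / (z; z²)_∞²`. -/
lemma tsum_lerchCoeff {z : ℂ} (hz : ‖z‖ < 1) :
    ∑' k, lerchCoeff z k = pochInf (z ^ 2) (z ^ 2) ^ 2 / pochInf z (z ^ 2) ^ 2 := by
  have hq : ‖z ^ 2‖ < 1 := norm_pow_succ_lt_one hz 1
  have hP := pochInf_ne_zero hq hq
  obtain ⟨L, hL0, hL⟩ := exists_norm_baileyWeight_le hq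
  have hlim : Tendsto (fun n => ∑' k, lerchCoeff z k * baileyWeight (z ^ 2) n k) atTop
      (𝓝 (∑' k, lerchCoeff z k * (1 / (pochInf (z ^ 2) (z ^ 2) * pochInf (z ^ 2) (z ^ 2))))) := by
    refine tendsto_tsum_of_dominated_convergence
      (bound := fun k => 2 / (1 - ‖z‖) * ‖z ^ 2‖ ^ k * L)
      (((summable_geometric_of_lt_one (norm_nonneg _) hq).mul_left _).mul_right _) (fun k => ?_)
      (Eventually.of_forall fun n k => ?_)
    · refine Tendsto.const_mul _ ?_
      have h1 := (tendsto_pochN (z ^ 2) hq).comp (tendsto_sub_atTop_nat k)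
      have h2 := (tendsto_pochN (z ^ 2) hq).comp (tendsto_add_atTop_nat (k + 1))
      have h3 := (tendsto_const_nhds (x := (1 : ℂ))).div (h1.mul h2) (mul_ne_zero hP hP)
      refine h3.congr' ?_
      filter_upwards [eventually_ge_atTop k] with n hn
      simp [baileyWeight, hn, add_assoc]
    · rw [norm_mul]
      have := norm_lerchCoeff_le hz k
      have := hL n k
      gcongr
  have hlim' : Tendsto (fun n => ∑' k, lerchCoeff z k * baileyWeight (z ^ 2) n k) atTop
      (𝓝 (1 / pochInf z (z ^ 2) ^ 2)) := by
    simp_rw [tsum_lerchCoeff_mul_baileyWeight hz]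
    exact tendsto_const_nhds.div (((tendsto_pochN z hq).comp (tendsto_add_atTop_nat 1)).pow 2)
      (pow_ne_zero 2 (pochInf_ne_zero hz hq))
  have h := tendsto_nhds_unique hlim hlim'
  rw [tsum_mul_right] at h
  field_simp at h ⊢
  rw [eq_div_iff (pow_ne_zero 2 (pochInf_ne_zero hz hq))]
  have h' := pochInf_ne_zero hz hq
  field_simp at h
  linear_combination h

lemma summable_lerchCoeff_mul_pow {z : ℂ} (hz : ‖z‖ < 1) :
    Summable fun k => lerchCoeff z k * (z ^ 2) ^ ((k + 1).choose 2) := by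
  have hq : ‖z ^ 2‖ < 1 := norm_pow_succ_lt_one hz 1
  refine ((summable_geometric_of_lt_one (norm_nonneg _) hq).mul_left (2 / (1 - ‖z‖))).of_norm_bounded
    fun k => ?_
  rw [norm_mul]
  refine le_trans (mul_le_of_le_one_right (norm_nonneg _) ?_) (norm_lerchCoeff_le hz k)
  exact (norm_pow_choose_le hq k).trans (pow_le_one₀ (norm_nonneg _) hq.le)

/-- The Appell–Lerch representation of `B`. -/
lemma Bmock_eq_tsum_lerchCoeff {z : ℂ} (hz : ‖z‖ < 1) (hz0 : z ≠ 0) :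
    Bmock z = pochInf (-z ^ 2) (z ^ 2) / pochInf (z ^ 2) (z ^ 2) *
      ∑' k, lerchCoeff z k * (z ^ 2) ^ ((k + 1).choose 2) := by
  have hq : ‖z ^ 2‖ < 1 := norm_pow_succ_lt_one hz 1
  have h1 : Bmock z = ∑' n, ∑' k, lerchCoeff z k * gaussTerm (z ^ 2) n k := by
    refine tsum_congr fun n => ?_
    have he : n * (n + 1) = 2 * (n + 1).choose 2 := by
      rw [Nat.choose_two_right, Nat.add_sub_cancel, Nat.mul_div_cancel' (by
        simpa [mul_comm] using (Nat.even_mul_succ_self n).two_dvd), mul_comm]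
    rw [div_eq_mul_one_div, ← tsum_lerchCoeff_mul_baileyWeight hz, ← tsum_mul_left, he, pow_mul]
    refine tsum_congr fun k => ?_
    rw [gaussTerm]
    ring
  have hsum : Summable (Function.uncurry fun n k => lerchCoeff z k * gaussTerm (z ^ 2) n k) := by
    obtain ⟨M, hM0, hM⟩ := exists_norm_gaussTerm_le hq
    have hg := summable_geometric_of_lt_one (norm_nonneg _) hq
    have h4 : 0 < 1 - ‖z‖ := by linarith
    refine ((hg.mul_left M).mul_of_nonneg (hg.mul_left (2 / (1 - ‖z‖)))
      (fun n => by positivity) (fun n => by positivity)).of_norm_bounded fun p => ?_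
    rw [Function.uncurry, norm_mul, mul_comm]
    exact mul_le_mul (hM _ _) (norm_lerchCoeff_le hz _) (norm_nonneg _) (by positivity)
  rw [h1, ← hsum.tsum_comm, ← tsum_mul_left]
  refine tsum_congr fun k => ?_
  rw [tsum_mul_left, tsum_gaussTerm hq (pow_ne_zero 2 hz0)]
  ring

lemma lerchCoeff_even_part {z : ℂ} (hz : ‖z‖ < 1) (k : ℕ) :
    lerchCoeff z k * (z ^ 2) ^ ((k + 1).choose 2) +
      lerchCoeff (-z) k * ((-z) ^ 2) ^ ((k + 1).choose 2) = 2 * lerchCoeff (z ^ 2) k := by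
  have hq : ‖z ^ 2‖ < 1 := norm_pow_succ_lt_one hz 1
  have h1 := one_sub_pow_succ_ne_zero hz (2 * k)
  have h2 := one_sub_pow_succ_ne_zero (q := -z) (by simpa using hz) (2 * k)
  have h3 := one_sub_pow_succ_ne_zero hq (2 * k)
  have h4 : (-z) ^ (2 * k + 1) = -z ^ (2 * k + 1) := Odd.neg_pow ⟨k, rfl⟩ z
  rw [h4] at h2
  simp only [lerchCoeff, h4, neg_sq, ← pow_mul z 2 (2 * k + 1), mul_comm 2 (2 * k + 1),
    pow_mul z (2 * k + 1) 2] at *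
  generalize z ^ (2 * k + 1) = w at *
  rw [sub_neg_eq_add] at *
  field_simp
  ring

lemma pochInf_self_mul_pochInf_neg {q : ℂ} (hq : ‖q‖ < 1) :
    pochInf q q * pochInf (-q) q = pochInf (q ^ 2) (q ^ 2) := by
  rw [pochInf, pochInf, ← (multipliable_pochInf q hq).tprod_mul (multipliable_pochInf (-q) hq)]
  exact tprod_congr fun j => by ring

lemma pochInf_odd_mul_pochInf_even {q : ℂ} (hq : ‖q‖ < 1) :
    pochInf q (q ^ 2) * pochInf (q ^ 2) (q ^ 2) = pochInf q q := by
  have hq2 : ‖q ^ 2‖ < 1 := norm_pow_succ_lt_one hq 1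
  have h1 : ∀ j, 1 - q * (q ^ 2) ^ j = 1 - q * q ^ (2 * j) := fun j => by rw [pow_mul]
  have h2 : ∀ j, 1 - q ^ 2 * (q ^ 2) ^ j = 1 - q * q ^ (2 * j + 1) := fun j => by ring
  have m1 := multipliable_pochInf q hq2
  have m2 := multipliable_pochInf (q ^ 2) hq2
  simp only [h1, h2] at m1 m2
  simp only [pochInf, h1, h2]
  exact tprod_even_mul_odd (f := fun j => 1 - q * q ^ j) m1 m2

/-- The even sieve of `B(q)` with `q ↦ q^{1/2}` is the eta quotient
`(q²;q²)_∞⁵ / (q;q)_∞⁴`: writing the sieved-and-rescaled series at `q = z²` as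
`(B(z) + B(−z))/2`, we have `(B(z) + B(−z))/2 = (z⁴;z⁴)_∞⁵ / (z²;z²)_∞⁴`. -/
theorem stmt5 (z : ℂ) (hz : ‖z‖ < 1) :
    (Bmock z + Bmock (-z)) / 2 =
      pochInf (z ^ 4) (z ^ 4) ^ 5 / pochInf (z ^ 2) (z ^ 2) ^ 4 := by
  rcases eq_or_ne z 0 with rfl | hz0
  · have h : Bmock 0 = 1 := by
      rw [Bmock, tsum_eq_single 0 fun n hn => by simp [hn]]
      simp [pochN]
    simp [h, pochInf]
  have hz' : ‖-z‖ < 1 := by simpa using hz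
  have hq : ‖z ^ 2‖ < 1 := norm_pow_succ_lt_one hz 1
  have hq2 : ‖(z ^ 2) ^ 2‖ < 1 := norm_pow_succ_lt_one hq 1
  rw [Bmock_eq_tsum_lerchCoeff hz hz0, Bmock_eq_tsum_lerchCoeff hz' (neg_ne_zero.mpr hz0),
    neg_sq, ← mul_add, ← Summable.tsum_add (summable_lerchCoeff_mul_pow hz)
      (by simpa only [neg_sq] using summable_lerchCoeff_mul_pow hz')]
  have h := fun k => lerchCoeff_even_part hz k
  simp only [neg_sq] at h
  simp only [h]
  rw [tsum_mul_left, tsum_lerchCoeff hq, show z ^ 4 = (z ^ 2) ^ 2 by ring]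
  have h1 := pochInf_self_mul_pochInf_neg hq
  have h2 := pochInf_odd_mul_pochInf_even hq
  have h3 := pochInf_ne_zero hq hq
  have h4 := pochInf_ne_zero hq hq2
  have h5 := pochInf_ne_zero hq2 hq2
  generalize z ^ 2 = q at *
  rw [← h2] at h1 h3 ⊢
  have h6 : pochInf (-q) q = 1 / pochInf q (q ^ 2) := by
    rw [eq_div_iff h4]
    refine mul_right_cancel₀ h5 ?_
    linear_combination h1
  rw [h6]
  field_simp
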